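/- arXiv:math/0412509 — 3 statements merged into one kernel-verified Lean document; each statement's English description precedes it below -/
import Mathlib

section
/- Let k ≥ 1 and let j_1, …, j_k ∈ {1, …, n} be any sequence of indices. If f is a holomorphic function on Ω all of whose partial derivatives of order at most k − 1 vanish at the origin (i.e. (∂^α f)(0) = 0 for every multi-index α with |α| ≤ k − 1), then (E_{j_1}(E_{j_2}(⋯(E_{j_k} f)⋯)))(0) = (∂_{j_1}∂_{j_2}⋯∂_{j_k} f)(0). -/
/-- The `i`-th partial derivative of `f : ℂⁿ → ℂ`. -/
noncomputable def pd (n : ℕ) (i : Fin n) (f : (Fin n → ℂ) → ℂ) : (Fin n → ℂ) → ℂ :=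
  fun z => fderiv ℂ f z (Pi.single i 1)

/-- Iterated partial derivatives along a list of indices: the first element of the
list is applied outermost, i.e. `pdSeq n [j₁,…,j_k] f = ∂_{j₁} ⋯ ∂_{j_k} f`. -/
noncomputable def pdSeq (n : ℕ) (l : List (Fin n)) (f : (Fin n → ℂ) → ℂ) : (Fin n → ℂ) → ℂ :=
  l.foldr (pd n) f

/-- `∂^α f = ∂_1^{α₁} ⋯ ∂_n^{αₙ} f` for a multi-index `α`. -/
noncomputable def pdPow (n : ℕ) (α : Fin n → ℕ) (f : (Fin n → ℂ) → ℂ) : (Fin n → ℂ) → ℂ :=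
  pdSeq n ((List.finRange n).flatMap fun i => List.replicate (α i) i) f

/-- The first-order operator `E_i = ∂_i + ∑_j F_i^j ∂_j`. -/
noncomputable def Eop (n : ℕ) (F : Fin n → Fin n → (Fin n → ℂ) → ℂ) (i : Fin n)
    (f : (Fin n → ℂ) → ℂ) : (Fin n → ℂ) → ℂ :=
  fun z => pd n i f z + ∑ j, F i j z * pd n j f z

/-- Iterated application `E_{j₁}(E_{j₂}(⋯(E_{j_k} f)⋯))` for a list `[j₁,…,j_k]`. -/
noncomputable def EopSeq (n : ℕ) (F : Fin n → Fin n → (Fin n → ℂ) → ℂ)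
    (l : List (Fin n)) (f : (Fin n → ℂ) → ℂ) : (Fin n → ℂ) → ℂ :=
  l.foldr (Eop n F) f

/-- `f` is analytic on `Ω` and vanishes to order `m` at the origin. -/
def VanOrd (n : ℕ) (Ω : Set (Fin n → ℂ)) : ℕ → ((Fin n → ℂ) → ℂ) → Prop
  | 0, f => AnalyticOnNhd ℂ f Ω
  | m + 1, f => AnalyticOnNhd ℂ f Ω ∧ f 0 = 0 ∧ ∀ i, VanOrd n Ω m (pd n i f)

section helpers

variable {n : ℕ} {Ω : Set (Fin n → ℂ)}

theorem pd_analytic {f : (Fin n → ℂ) → ℂ} (hf : AnalyticOnNhd ℂ f Ω) (i : Fin n) :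
    AnalyticOnNhd ℂ (pd n i f) Ω := by
  intro z hz
  have h := (hf z hz).fderiv
  exact ((ContinuousLinearMap.apply ℂ ℂ (Pi.single i 1 : Fin n → ℂ)).analyticAt _).comp h

theorem pd_congr (hΩ : IsOpen Ω) {f g : (Fin n → ℂ) → ℂ} (h : Set.EqOn f g Ω) (i : Fin n) :
    Set.EqOn (pd n i f) (pd n i g) Ω := by
  intro z hz
  have : f =ᶠ[nhds z] g := h.eventuallyEq_of_mem (hΩ.mem_nhds hz)
  simp only [pd, this.fderiv_eq]

theorem pdSeq_analytic {f : (Fin n → ℂ) → ℂ} (hf : AnalyticOnNhd ℂ f Ω) (l : List (Fin n)) :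
    AnalyticOnNhd ℂ (pdSeq n l f) Ω := by
  induction l with
  | nil => exact hf
  | cons i l ih => exact pd_analytic ih i

theorem pd_comm {f : (Fin n → ℂ) → ℂ} (hf : AnalyticOnNhd ℂ f Ω) (i j : Fin n) :
    Set.EqOn (pd n i (pd n j f)) (pd n j (pd n i f)) Ω := by
  have key : ∀ i j : Fin n, ∀ z ∈ Ω, pd n i (pd n j f) z =
      fderiv ℂ (fderiv ℂ f) z (Pi.single i 1) (Pi.single j 1) := by
    intro i j z hz
    have hd : DifferentiableAt ℂ (fderiv ℂ f) z := (hf z hz).fderiv.differentiableAt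
    have h2 := (hd.hasFDerivAt.clm_apply (hasFDerivAt_const (Pi.single j 1 : Fin n → ℂ) z)).fderiv
    unfold pd
    rw [h2]
    simp
  intro z hz
  rw [key i j z hz, key j i z hz]
  have hc : ContDiffAt ℂ 2 f z := (hf z hz).contDiffAt
  exact (hc.isSymmSndFDerivAt (by simp)).eq _ _

theorem pdSeq_perm (hΩ : IsOpen Ω) {f : (Fin n → ℂ) → ℂ} (hf : AnalyticOnNhd ℂ f Ω)
    {l l' : List (Fin n)} (h : l.Perm l') : Set.EqOn (pdSeq n l f) (pdSeq n l' f) Ω := by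
  induction h with
  | nil => exact fun _ _ => rfl
  | cons i _ ih => exact pd_congr hΩ ih i
  | swap i j l => exact pd_comm (pdSeq_analytic hf l) j i
  | trans _ _ h1 h2 => exact h1.trans h2

theorem VanOrd.analytic {m : ℕ} {f : (Fin n → ℂ) → ℂ} (h : VanOrd n Ω m f) :
    AnalyticOnNhd ℂ f Ω := by
  cases m with
  | zero => exact h
  | succ m => exact h.1

theorem VanOrd.pred {m : ℕ} : ∀ {f : (Fin n → ℂ) → ℂ}, VanOrd n Ω (m + 1) f → VanOrd n Ω m f := by
  induction m with
  | zero => exact fun h => h.1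
  | succ m ih => exact fun h => ⟨h.1, h.2.1, fun i => ih (h.2.2 i)⟩

theorem VanOrd.congr (hΩ : IsOpen Ω) (h0 : (0 : Fin n → ℂ) ∈ Ω) {m : ℕ} :
    ∀ {f g : (Fin n → ℂ) → ℂ}, VanOrd n Ω m f → Set.EqOn f g Ω → VanOrd n Ω m g := by
  induction m with
  | zero => exact fun h e => AnalyticOnNhd.congr hΩ h e
  | succ m ih =>
    exact fun h e => ⟨AnalyticOnNhd.congr hΩ h.1 e, (e h0) ▸ h.2.1,
      fun i => ih (h.2.2 i) (pd_congr hΩ e i)⟩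

theorem pd_add {f g : (Fin n → ℂ) → ℂ} (hf : AnalyticOnNhd ℂ f Ω) (hg : AnalyticOnNhd ℂ g Ω)
    (i : Fin n) : Set.EqOn (pd n i f + pd n i g) (pd n i (f + g)) Ω := by
  intro z hz
  simp only [pd, Pi.add_apply]
  rw [fderiv_add (hf z hz).differentiableAt (hg z hz).differentiableAt]
  simp

theorem pd_sub {f g : (Fin n → ℂ) → ℂ} (hf : AnalyticOnNhd ℂ f Ω) (hg : AnalyticOnNhd ℂ g Ω)
    (i : Fin n) : Set.EqOn (pd n i (f - g)) (pd n i f - pd n i g) Ω := by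
  intro z hz
  simp only [pd, Pi.sub_apply]
  rw [fderiv_sub (hf z hz).differentiableAt (hg z hz).differentiableAt]
  simp

theorem pd_mul {f g : (Fin n → ℂ) → ℂ} (hf : AnalyticOnNhd ℂ f Ω) (hg : AnalyticOnNhd ℂ g Ω)
    (i : Fin n) : Set.EqOn (pd n i f * g + f * pd n i g) (pd n i (f * g)) Ω := by
  intro z hz
  simp only [pd, Pi.add_apply, Pi.mul_apply]
  rw [fderiv_mul (hf z hz).differentiableAt (hg z hz).differentiableAt]
  simp
  ring

theorem VanOrd.add (hΩ : IsOpen Ω) (h0 : (0 : Fin n → ℂ) ∈ Ω) {m : ℕ} :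
    ∀ {f g : (Fin n → ℂ) → ℂ}, VanOrd n Ω m f → VanOrd n Ω m g → VanOrd n Ω m (f + g) := by
  induction m with
  | zero => exact fun hf hg => AnalyticOnNhd.add hf hg
  | succ m ih =>
    exact fun hf hg => ⟨AnalyticOnNhd.add hf.1 hg.1, by simp [hf.2.1, hg.2.1],
      fun i => (ih (hf.2.2 i) (hg.2.2 i)).congr hΩ h0 (pd_add hf.1 hg.1 i)⟩

theorem VanOrd.zero {m : ℕ} : VanOrd n Ω m (0 : (Fin n → ℂ) → ℂ) := by
  induction m with
  | zero => exact fun _ _ => analyticAt_const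
  | succ m ih =>
    refine ⟨fun _ _ => analyticAt_const, rfl, fun i => ?_⟩
    have : pd n i (0 : (Fin n → ℂ) → ℂ) = 0 := by
      funext z
      simp [pd]
    rw [this]
    exact ih

theorem VanOrd.sum (hΩ : IsOpen Ω) (h0 : (0 : Fin n → ℂ) ∈ Ω) {m : ℕ} (s : Finset (Fin n))
    {f : Fin n → (Fin n → ℂ) → ℂ} (h : ∀ i, VanOrd n Ω m (f i)) :
    VanOrd n Ω m (∑ i ∈ s, f i) := by
  classical
  induction s using Finset.induction_on with
  | empty => simpa using VanOrd.zero
  | insert a s ha ih =>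
    rw [Finset.sum_insert ha]
    exact (h a).add hΩ h0 ih

theorem VanOrd.mul_left (hΩ : IsOpen Ω) (h0 : (0 : Fin n → ℂ) ∈ Ω) {m : ℕ} :
    ∀ {f g : (Fin n → ℂ) → ℂ}, AnalyticOnNhd ℂ f Ω → VanOrd n Ω m g → VanOrd n Ω m (f * g) := by
  induction m with
  | zero => exact fun hf hg => AnalyticOnNhd.mul hf hg
  | succ m ih =>
    exact fun hf hg => ⟨AnalyticOnNhd.mul hf hg.1, by simp [hg.2.1],
      fun i => ((ih (pd_analytic hf i) hg.pred).add hΩ h0 (ih hf (hg.2.2 i))).congr hΩ h0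
        (pd_mul hf hg.1 i)⟩

theorem VanOrd.mul_left_zero (hΩ : IsOpen Ω) (h0 : (0 : Fin n → ℂ) ∈ Ω) {m : ℕ} :
    ∀ {f g : (Fin n → ℂ) → ℂ}, AnalyticOnNhd ℂ f Ω → f 0 = 0 → VanOrd n Ω m g →
      VanOrd n Ω (m + 1) (f * g) := by
  induction m with
  | zero =>
    exact fun hf hf0 hg => ⟨AnalyticOnNhd.mul hf hg, by simp [hf0],
      fun i => pd_analytic (AnalyticOnNhd.mul hf hg) i⟩
  | succ m ih =>
    exact fun hf hf0 hg => ⟨AnalyticOnNhd.mul hf hg.1, by simp [hf0],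
      fun i => ((VanOrd.mul_left hΩ h0 (pd_analytic hf i) hg).add hΩ h0
        (ih hf hf0 (hg.2.2 i))).congr hΩ h0 (pd_mul hf hg.1 i)⟩

theorem VanOrd.of_list {m : ℕ} : ∀ {f : (Fin n → ℂ) → ℂ}, AnalyticOnNhd ℂ f Ω →
    (∀ l : List (Fin n), l.length < m → pdSeq n l f 0 = 0) → VanOrd n Ω m f := by
  induction m with
  | zero => exact fun hf _ => hf
  | succ m ih =>
    refine fun {f} hf h => ⟨hf, h [] (by simp), fun i => ih (pd_analytic hf i) fun l hl => ?_⟩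
    have := h (l ++ [i]) (by simpa using hl)
    simpa [pdSeq] using this

theorem Eop_eq (F : Fin n → Fin n → (Fin n → ℂ) → ℂ) (i : Fin n) (g : (Fin n → ℂ) → ℂ) :
    Eop n F i g = pd n i g + ∑ j, F i j * pd n j g := by
  funext z
  simp [Eop]

theorem main_aux (hΩ : IsOpen Ω) (h0 : (0 : Fin n → ℂ) ∈ Ω)
    (F : Fin n → Fin n → (Fin n → ℂ) → ℂ)
    (hF : ∀ i j, AnalyticOnNhd ℂ (F i j) Ω) (hF0 : ∀ i j, F i j 0 = 0)
    (f : (Fin n → ℂ) → ℂ) (l : List (Fin n)) : ∀ m : ℕ, VanOrd n Ω (m + l.length) f →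
    VanOrd n Ω m (EopSeq n F l f) ∧ VanOrd n Ω (m + 1) (EopSeq n F l f - pdSeq n l f) := by
  induction l with
  | nil =>
    intro m h
    refine ⟨h, ?_⟩
    have : EopSeq n F [] f - pdSeq n [] f = 0 := by simp [EopSeq, pdSeq]
    rw [this]
    exact VanOrd.zero
  | cons i l ih =>
    intro m h
    have hfa := h.analytic
    obtain ⟨h1, h2⟩ := ih (m + 1) (by
      have e : m + (i :: l).length = m + 1 + l.length := by
        simp only [List.length_cons]
        omega
      rwa [e] at h)
    have hS : VanOrd n Ω (m + 1) (∑ j, F i j * pd n j (EopSeq n F l f)) :=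
      VanOrd.sum hΩ h0 _ fun j => VanOrd.mul_left_zero hΩ h0 (hF i j) (hF0 i j) (h1.2.2 j)
    have e1 : EopSeq n F (i :: l) f = Eop n F i (EopSeq n F l f) := rfl
    have e2 : pdSeq n (i :: l) f = pd n i (pdSeq n l f) := rfl
    rw [e1, e2, Eop_eq]
    refine ⟨(h1.2.2 i).add hΩ h0 hS.pred, ?_⟩
    refine ((h2.2.2 i).add hΩ h0 hS).congr hΩ h0 ?_
    intro z hz
    have := pd_sub h1.1 (pdSeq_analytic hfa l) i hz
    simp only [Pi.add_apply, Pi.sub_apply] at this ⊢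
    rw [this]
    ring

end helpers

theorem stmt_1 (n : ℕ) (hn : 1 ≤ n) (Ω : Set (Fin n → ℂ)) (hΩ : IsOpen Ω)
    (h0 : (0 : Fin n → ℂ) ∈ Ω)
    (F : Fin n → Fin n → (Fin n → ℂ) → ℂ)
    (hF : ∀ i j, AnalyticOnNhd ℂ (F i j) Ω) (hF0 : ∀ i j, F i j 0 = 0)
    (k : ℕ) (hk : 1 ≤ k) (j : Fin k → Fin n)
    (f : (Fin n → ℂ) → ℂ) (hf : AnalyticOnNhd ℂ f Ω)
    (hvanish : ∀ α : Fin n → ℕ, (∑ i, α i) ≤ k - 1 → pdPow n α f 0 = 0) :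
    EopSeq n F (List.ofFn j) f 0 = pdSeq n (List.ofFn j) f 0 := by
  have hV : VanOrd n Ω (0 + (List.ofFn j).length) f := by
    rw [List.length_ofFn, zero_add]
    refine VanOrd.of_list hf fun l hl => ?_
    have hsum : ∑ i, l.count i = l.length := by
      have := Multiset.sum_count_eq_card (s := Finset.univ) (m := (l : Multiset (Fin n)))
        (fun a _ => Finset.mem_univ a)
      simpa using this
    have hp : l.Perm ((List.finRange n).flatMap fun i => List.replicate (l.count i) i) := by
      rw [List.perm_iff_count]
      intro a
      rw [List.count_flatMap]
      have : (List.count a ∘ fun i => List.replicate (l.count i) i)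
          = fun i => if i = a then l.count a else 0 := by
        funext i
        by_cases h : i = a
        · subst h
          simp
        · simp [List.count_replicate, h]
      rw [this, ← List.ofFn_eq_map, List.sum_ofFn]
      simp
    rw [pdSeq_perm hΩ hf hp h0]
    exact hvanish (fun i => l.count i) (by
      rw [hsum]
      omega)
  have h := (main_aux hΩ h0 F hF hF0 f (List.ofFn j) 0 hV).2.2.1
  exact sub_eq_zero.mp h
end

section
/- Assume in addition that Ω is connected. Let f be a holomorphic function on Ω such that for every i ∈ {1, …, n} there exists a holomorphic function h_i on Ω with (E_i f)(z) = h_i(z) f(z) for all z ∈ Ω. If moreover f(0) = 0, then f is identically zero on Ω. -/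
theorem stmt_2 (n : ℕ) (hn : 1 ≤ n) (Ω : Set (Fin n → ℂ)) (hΩ : IsOpen Ω)
    (h0 : (0 : Fin n → ℂ) ∈ Ω) (hconn : IsConnected Ω)
    (F : Fin n → Fin n → (Fin n → ℂ) → ℂ)
    (hF : ∀ i j, AnalyticOnNhd ℂ (F i j) Ω) (hF0 : ∀ i j, F i j 0 = 0)
    (f : (Fin n → ℂ) → ℂ) (hf : AnalyticOnNhd ℂ f Ω)
    (hE : ∀ i : Fin n, ∃ h : (Fin n → ℂ) → ℂ, AnalyticOnNhd ℂ h Ω ∧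
      ∀ z ∈ Ω, Eop n F i f z = h z * f z)
    (hf0 : f 0 = 0) :
    ∀ z ∈ Ω, f z = 0 := by
  choose h hh hEh using hE
  have hn' : (0 : ℝ) < n := by exact_mod_cast hn
  have hev : ∀ᶠ z in nhds (0 : Fin n → ℂ), z ∈ Ω ∧ (∀ i j, ‖F i j z‖ < 1 / (2 * n)) ∧
      ∀ i, ‖h i z‖ < ‖h i 0‖ + 1 := by
    refine Filter.Eventually.and (hΩ.mem_nhds h0) (Filter.Eventually.and ?_ ?_)
    · rw [Filter.eventually_all]; intro i
      rw [Filter.eventually_all]; intro j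
      have hc := ((hF i j 0 h0).continuousAt.norm)
      refine hc.eventually_lt continuousAt_const ?_
      rw [hF0]; simp only [norm_zero]; positivity
    · rw [Filter.eventually_all]; intro i
      have hc := ((hh i 0 h0).continuousAt.norm)
      exact hc.eventually_lt continuousAt_const (by linarith)
  obtain ⟨r, hr, hball⟩ := Metric.eventually_nhds_iff_ball.1 hev
  set C : ℝ := ∑ i, (‖h i 0‖ + 1) with hC
  have key : ∀ z ∈ Metric.ball (0 : Fin n → ℂ) r, ∑ i, ‖pd n i f z‖ ≤ 2 * C * ‖f z‖ := by
    intro z hz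
    obtain ⟨hzΩ, hFz, hhz⟩ := hball z hz
    set M := ∑ i, ‖pd n i f z‖ with hM
    have h1 : ∀ i, ‖pd n i f z‖ ≤ (‖h i 0‖ + 1) * ‖f z‖ + 1 / (2 * n) * M := by
      intro i
      have e : pd n i f z = h i z * f z - ∑ j, F i j z * pd n j f z := by
        rw [← hEh i z hzΩ]; simp [Eop]
      rw [e]
      refine (norm_sub_le _ _).trans (add_le_add ?_ ?_)
      · rw [norm_mul]; gcongr; exact (hhz i).le
      · rw [hM, Finset.mul_sum]
        refine (norm_sum_le _ _).trans (Finset.sum_le_sum fun j _ => ?_)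
        rw [norm_mul]; gcongr; exact (hFz i j).le
    have h2 : M ≤ C * ‖f z‖ + M / 2 := by
      calc M ≤ ∑ i, ((‖h i 0‖ + 1) * ‖f z‖ + 1 / (2 * n) * M) :=
            Finset.sum_le_sum fun i _ => h1 i
        _ = C * ‖f z‖ + M / 2 := by
            rw [Finset.sum_add_distrib, ← Finset.sum_mul, ← hC, Finset.sum_const, Finset.card_univ,
              Fintype.card_fin, nsmul_eq_mul]
            field_simp
    linarith
  have hloc : ∀ z ∈ Metric.ball (0 : Fin n → ℂ) r, f z = 0 := by
    intro z hz
    have hmem : ∀ t ∈ Set.Icc (0 : ℝ) 1, t • z ∈ Metric.ball (0 : Fin n → ℂ) r := by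
      intro t ht
      rw [mem_ball_zero_iff] at hz ⊢
      rw [norm_smul, Real.norm_of_nonneg ht.1]
      exact (mul_le_of_le_one_left (norm_nonneg _) ht.2).trans_lt hz
    have hd : ∀ t ∈ Set.Icc (0 : ℝ) 1,
        HasDerivAt (fun t : ℝ => f (t • z)) (fderiv ℂ f (t • z) z) t := by
      intro t ht
      have hA := ((hf _ (hball _ (hmem t ht)).1).differentiableAt.hasFDerivAt).restrictScalars ℝ
      have hB : HasDerivAt (fun t : ℝ => t • z) z t := by
        simpa using (hasDerivAt_id t).smul_const z
      exact hA.comp_hasDerivAt t hB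
    have hres := eq_zero_of_abs_deriv_le_mul_abs_self_of_eq_zero_right
      (f := fun t : ℝ => f (t • z)) (f' := fun t => fderiv ℂ f (t • z) z)
      (K := ‖z‖ * (2 * C)) (a := 0) (b := 1)
      (fun t ht => (hd t ht).continuousAt.continuousWithinAt)
      (fun t ht => (hd t (Set.Ico_subset_Icc_self ht)).hasDerivWithinAt)
      (by simpa using hf0) (by
        intro t ht
        have hk := key _ (hmem t (Set.Ico_subset_Icc_self ht))
        have e : fderiv ℂ f (t • z) z = ∑ i, z i * pd n i f (t • z) := by
          have e' : ∀ L : (Fin n → ℂ) →L[ℂ] ℂ, L z = ∑ i, z i * L (Pi.single i 1) := by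
            intro L
            conv_lhs => rw [pi_eq_sum_univ' z]
            simp
          exact e' _
        rw [e, mul_assoc]
        refine (norm_sum_le _ _).trans (le_trans ?_ (mul_le_mul_of_nonneg_left hk (norm_nonneg z)))
        rw [Finset.mul_sum]
        refine Finset.sum_le_sum fun j _ => ?_
        rw [norm_mul]; gcongr; exact norm_le_pi_norm z j)
    simpa using hres 1 (by simp)
  have := hf.eqOn_zero_of_preconnected_of_eventuallyEq_zero hconn.isPreconnected h0
    (Filter.eventually_of_mem (Metric.ball_mem_nhds 0 hr) hloc)
  exact fun z hz => this hz
end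

section
/- Let f be a holomorphic function on Ω such that for every i ∈ {1, …, n} there exists a holomorphic function h_i on Ω with (E_i f)(z) = h_i(z) f(z) for all z ∈ Ω, and assume f(0) = 0. Then every iterated partial derivative of f vanishes at the origin: (∂^α f)(0) = 0 for every multi-index α ∈ ℤ_{≥0}^n. -/
open Topology Filter

theorem aux_det {n : ℕ} (M : (Fin n → ℂ) → Matrix (Fin n) (Fin n) ℂ)
    (hM : ∀ i j, AnalyticAt ℂ (fun z => M z i j) 0) :
    AnalyticAt ℂ (fun z => (M z).det) 0 := by
  simp only [Matrix.det_apply', ]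
  refine Finset.analyticAt_fun_sum _ fun σ _ => ?_
  refine analyticAt_const.mul ?_
  exact Finset.analyticAt_fun_prod _ fun i _ => hM _ _

theorem aux_adj {n : ℕ} (M : (Fin n → ℂ) → Matrix (Fin n) (Fin n) ℂ)
    (hM : ∀ i j, AnalyticAt ℂ (fun z => M z i j) 0) (i j : Fin n) :
    AnalyticAt ℂ (fun z => (M z).adjugate i j) 0 := by
  simp only [Matrix.adjugate_apply]
  refine aux_det _ fun a b => ?_
  by_cases h : a = j
  · subst h
    simp only [Matrix.updateRow_self]
    exact analyticAt_const
  · simp only [Matrix.updateRow_ne h]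
    exact hM a b

theorem aux_seq {n : ℕ} (f : (Fin n → ℂ) → ℂ) (hf : AnalyticAt ℂ f 0)
    (g : Fin n → (Fin n → ℂ) → ℂ) (hg : ∀ i, AnalyticAt ℂ (g i) 0)
    (hfg : ∀ i, pd n i f =ᶠ[𝓝 0] fun z => g i z * f z) (l : List (Fin n)) :
    ∃ k : (Fin n → ℂ) → ℂ, AnalyticAt ℂ k 0 ∧ pdSeq n l f =ᶠ[𝓝 0] fun z => k z * f z := by
  induction l with
  | nil => exact ⟨fun _ => 1, analyticAt_const, by simp [pdSeq]⟩
  | cons i l ih =>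
    obtain ⟨k, hk, he⟩ := ih
    refine ⟨fun z => pd n i k z + k z * g i z, ?_, ?_⟩
    · refine AnalyticAt.add ?_ (hk.mul (hg i))
      exact ((ContinuousLinearMap.apply ℂ ℂ (Pi.single i (1:ℂ) : Fin n → ℂ)).analyticAt _).comp hk.fderiv
    · filter_upwards [he.fderiv (𝕜 := ℂ), hk.eventually_analyticAt, hf.eventually_analyticAt, hfg i]
        with z h1 h2 h3 h4
      change fderiv ℂ (pdSeq n l f) z _ = _
      rw [h1, fderiv_fun_mul h2.differentiableAt h3.differentiableAt]
      simp only [pd] at h4 ⊢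
      simp [h4]
      ring

theorem stmt_3 (n : ℕ) (hn : 1 ≤ n) (Ω : Set (Fin n → ℂ)) (hΩ : IsOpen Ω)
    (h0 : (0 : Fin n → ℂ) ∈ Ω)
    (F : Fin n → Fin n → (Fin n → ℂ) → ℂ)
    (hF : ∀ i j, AnalyticOnNhd ℂ (F i j) Ω) (hF0 : ∀ i j, F i j 0 = 0)
    (f : (Fin n → ℂ) → ℂ) (hf : AnalyticOnNhd ℂ f Ω)
    (hE : ∀ i : Fin n, ∃ h : (Fin n → ℂ) → ℂ, AnalyticOnNhd ℂ h Ω ∧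
      ∀ z ∈ Ω, Eop n F i f z = h z * f z)
    (hf0 : f 0 = 0) :
    ∀ α : Fin n → ℕ, pdPow n α f 0 = 0 := by
  choose h hh hE using hE
  set M : (Fin n → ℂ) → Matrix (Fin n) (Fin n) ℂ :=
    fun z => 1 + Matrix.of (fun i j => F i j z) with hMdef
  have hM : ∀ i j, AnalyticAt ℂ (fun z => M z i j) 0 := fun i j => by
    simp only [hMdef, Matrix.add_apply, Matrix.of_apply]
    exact analyticAt_const.add (hF i j 0 h0)
  have hd := aux_det M hM
  have hM0 : M 0 = 1 := by
    ext i j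
    simp [hMdef, hF0]
  have hd0 : (M 0).det ≠ 0 := by simp [hM0]
  have key := aux_seq f (hf 0 h0)
    (fun i z => ((M z).det)⁻¹ * ∑ j, (M z).adjugate i j * h j z)
    (fun i => (hd.inv hd0).mul (Finset.analyticAt_fun_sum _ fun j _ =>
      (aux_adj M hM i j).mul (hh j 0 h0))) ?_
  · intro α
    obtain ⟨k, -, hk⟩ := key ((List.finRange n).flatMap fun i => List.replicate (α i) i)
    have := hk.self_of_nhds
    simpa [hf0, pdPow] using this
  · intro i
    filter_upwards [hΩ.mem_nhds h0, hd.continuousAt.eventually_ne hd0] with z hz hdz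
    have h1 : (M z).mulVec (fun j => pd n j f z) = fun j => h j z * f z := by
      ext j
      rw [← hE j z hz]
      simp [hMdef, Eop, Matrix.mulVec, dotProduct, add_mul, Finset.sum_add_distrib, Matrix.one_apply]
    have h2 := congrArg (fun v => (M z).adjugate.mulVec v i) h1
    simp only [Matrix.mulVec_mulVec, Matrix.adjugate_mul, Matrix.smul_mulVec,
      Matrix.one_mulVec, Pi.smul_apply, smul_eq_mul] at h2
    rw [mul_assoc, eq_inv_mul_iff_mul_eq₀ hdz, h2]
    simp [Matrix.mulVec, dotProduct, Finset.sum_mul, mul_assoc]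
end
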